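/- Let K be a compact metric space and ξ₁, ξ₂ countable ordinals. If f, g : K → ℝ are Baire class one functions with β(f) ≤ ω^{ξ₁} and β(g) ≤ ω^{ξ₂}, then β(f·g) ≤ ω^ξ, where ξ = max{ξ₁ + ξ₂, ξ₂ + ξ₁}. -/

import Mathlib

open Filter Topology Set Ordinal

noncomputable section

/-- One step of the oscillation derivation of `A` with respect to `f` and `ε`. -/
def oscStep {K : Type*} [TopologicalSpace K] (f : K → ℝ) (ε : ℝ) (A : Set K) : Set K :=
  {x ∈ A | ∀ U : Set K, IsOpen U → x ∈ U →
    ∃ x₁ ∈ U ∩ A, ∃ x₂ ∈ U ∩ A, ε ≤ |f x₁ - f x₂|}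

/-- The transfinite oscillation derivatives `H^α(f, ε)`. -/
def oscDeriv {K : Type*} [TopologicalSpace K] (f : K → ℝ) (ε : ℝ) (H : Set K) :
    Ordinal → Set K := fun α =>
  Ordinal.limitRecOn α H (fun _ ih => oscStep f ε ih)
    (fun _ _ ih => ⋂ (β : Ordinal) (h : _), ih β h)

/-- One step of the convergence derivation of `A` for a sequence `f`. -/
def seqStep {K : Type*} [TopologicalSpace K] (f : ℕ → K → ℝ) (ε : ℝ) (A : Set K) : Set K :=
  {x ∈ A | ∀ U : Set K, IsOpen U → x ∈ U → ∀ m : ℕ,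
    ∃ n₁ n₂ : ℕ, m < n₂ ∧ n₂ < n₁ ∧ ∃ x' ∈ U ∩ A, ε ≤ |f n₁ x' - f n₂ x'|}

/-- The transfinite convergence derivatives `H^α((fₙ), ε)`. -/
def seqDeriv {K : Type*} [TopologicalSpace K] (f : ℕ → K → ℝ) (ε : ℝ) (H : Set K) :
    Ordinal → Set K := fun α =>
  Ordinal.limitRecOn α H (fun _ ih => seqStep f ε ih)
    (fun _ _ ih => ⋂ (β : Ordinal) (h : _), ih β h)

open Classical in
/-- The least ordinal at which the family `S` is empty, and `ω₁` if there is none. -/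
def emptyIndex {K : Type*} (S : Ordinal → Set K) : Ordinal :=
  if _ : ∃ α, S α = ∅ then sInf {α | S α = ∅} else (Cardinal.aleph 1).ord

/-- The oscillation index `β_H(f, ε)`. -/
def betaEpsOn {K : Type*} [TopologicalSpace K] (f : K → ℝ) (ε : ℝ) (H : Set K) : Ordinal :=
  emptyIndex (oscDeriv f ε H)

/-- The oscillation index `β_H(f)`. -/
def betaOn {K : Type*} [TopologicalSpace K] (f : K → ℝ) (H : Set K) : Ordinal :=
  ⨆ ε : {e : ℝ // 0 < e}, betaEpsOn f ε.1 H

/-- The oscillation index `β(f)` over the whole space. -/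
def beta {K : Type*} [TopologicalSpace K] (f : K → ℝ) : Ordinal :=
  betaOn f Set.univ

/-- The convergence index `γ_H((fₙ), ε)`. -/
def gammaEpsOn {K : Type*} [TopologicalSpace K] (f : ℕ → K → ℝ) (ε : ℝ) (H : Set K) : Ordinal :=
  emptyIndex (seqDeriv f ε H)

/-- The convergence index `γ_H((fₙ))`. -/
def gammaOn {K : Type*} [TopologicalSpace K] (f : ℕ → K → ℝ) (H : Set K) : Ordinal :=
  ⨆ ε : {e : ℝ // 0 < e}, gammaEpsOn f ε.1 H

/-- The convergence index `γ((fₙ))` over the whole space. -/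
def gamma {K : Type*} [TopologicalSpace K] (f : ℕ → K → ℝ) : Ordinal :=
  gammaOn f Set.univ

/-- A function is of Baire class one if it is a pointwise limit of continuous functions. -/
def BaireOne {K : Type*} [TopologicalSpace K] (f : K → ℝ) : Prop :=
  ∃ F : ℕ → K → ℝ, (∀ n, Continuous (F n)) ∧
    ∀ x, Tendsto (fun n => F n x) atTop (nhds (f x))

/-- `f` is of Baire class one on the subspace `F`. -/
def BaireOneOn {K : Type*} [TopologicalSpace K] (f : K → ℝ) (F : Set K) : Prop :=
  ∃ g : ℕ → F → ℝ, (∀ n, Continuous (g n)) ∧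
    ∀ x : F, Tendsto (fun n => g n x) atTop (nhds (f x))

/-- `g` is a convex block combination of `f`. -/
def ConvexBlockOf {K : Type*} (g f : ℕ → K → ℝ) : Prop :=
  ∃ a : ℕ → ℝ, ∃ p : ℕ → ℕ, (∀ k, 0 ≤ a k) ∧ StrictMono p ∧ p 0 = 0 ∧
    (∀ n, ∑ k ∈ Finset.Ioc (p n) (p (n + 1)), a k = 1) ∧
    ∀ n x, g n x = ∑ k ∈ Finset.Ioc (p n) (p (n + 1)), a k * f k x

end

universe u

/-! ### A natural sum on ordinals -/

/-- The (Hessenberg-style) least strictly monotone sum. -/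
noncomputable def hsum (a b : Ordinal.{u}) : Ordinal.{u} :=
  max (⨆ x : Set.Iio a, (hsum x.1 b + 1)) (⨆ x : Set.Iio b, (hsum a x.1 + 1))
termination_by (a, b)
decreasing_by all_goals cases x; decreasing_tactic

theorem hsum_lt_left {a a' : Ordinal.{u}} (b : Ordinal.{u}) (h : a' < a) :
    hsum a' b < hsum a b := by
  rw [hsum.eq_def a b, ← Order.add_one_le_iff]
  exact le_max_of_le_left
    (Ordinal.le_iSup (fun x : Set.Iio a => hsum x.1 b + 1) ⟨a', h⟩)

theorem hsum_lt_right (a : Ordinal.{u}) {b b' : Ordinal.{u}} (h : b' < b) :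
    hsum a b' < hsum a b := by
  rw [hsum.eq_def a b, ← Order.add_one_le_iff]
  exact le_max_of_le_right
    (Ordinal.le_iSup (fun x : Set.Iio b => hsum a x.1 + 1) ⟨b', h⟩)

theorem hsum_le_of {a b c : Ordinal.{u}} (h1 : ∀ a' < a, hsum a' b < c)
    (h2 : ∀ b' < b, hsum a b' < c) : hsum a b ≤ c := by
  rw [hsum.eq_def a b]
  refine max_le (Ordinal.iSup_le fun x => ?_) (Ordinal.iSup_le fun x => ?_)
  · exact Order.add_one_le_of_lt (h1 _ x.2)
  · exact Order.add_one_le_of_lt (h2 _ x.2)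

theorem hsum_mono {a a' b b' : Ordinal.{u}} (h1 : a' ≤ a) (h2 : b' ≤ b) :
    hsum a' b' ≤ hsum a b := by
  have e1 : hsum a' b' ≤ hsum a b' := by
    rcases h1.eq_or_lt with rfl | h
    · exact le_rfl
    · exact (hsum_lt_left _ h).le
  refine e1.trans ?_
  rcases h2.eq_or_lt with rfl | h
  · exact le_rfl
  · exact (hsum_lt_right _ h).le

theorem hsum_decomp (p : Ordinal.{u}) (hp : 0 < p)
    (H : ∀ x y, x < p → y < p → hsum x y < p) (a b : Ordinal.{u}) :
    ∀ (n m : ℕ) (x y : Ordinal.{u}), x < p → y < p → a = p * n + x → b = p * m + y →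
      hsum a b ≤ p * ((n + m : ℕ) : Ordinal.{u}) + hsum x y := by
  have key : ∀ (a' p x : Ordinal.{u}) (n : ℕ), 0 < p → x < p → a' < p * n + x →
      ∃ (n' : ℕ) (x' : Ordinal.{u}), x' < p ∧ a' = p * n' + x' ∧
        (n' < n ∨ (n' = n ∧ x' < x)) := by
    intro a' p x n hp hx ha
    have hq : a' / p ≤ n := by
      have : a' / p < n + 1 := by
        rw [← Ordinal.lt_mul_iff_div_lt hp.ne']
        rw [mul_add, mul_one]
        exact ha.trans (by simpa using hx)
      exact Order.lt_add_one_iff.1 this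
    obtain ⟨n', hn'⟩ := Ordinal.lt_omega0.1 (hq.trans_lt (Ordinal.natCast_lt_omega0 n))
    refine ⟨n', a' % p, Ordinal.mod_lt _ hp.ne', ?_, ?_⟩
    · rw [← hn']; exact (Ordinal.div_add_mod a' p).symm
    · rw [hn'] at hq
      rcases (Nat.cast_le.1 hq).lt_or_eq with h | h
      · exact Or.inl h
      · refine Or.inr ⟨h, ?_⟩
        rw [← Ordinal.div_add_mod a' p, hn', h] at ha
        simpa using ha
  have small : ∀ (k l : ℕ) (s t : Ordinal.{u}), s < p → k < l →
      p * (k : Ordinal.{u}) + s < p * (l : Ordinal.{u}) + t := by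
    intro k l s t hs hkl
    calc p * (k : Ordinal.{u}) + s < p * (k : Ordinal.{u}) + p := by simpa using hs
      _ = p * ((k + 1 : ℕ) : Ordinal.{u}) := by push_cast; rw [mul_add, mul_one]
      _ ≤ p * (l : Ordinal.{u}) := by gcongr; exact_mod_cast hkl
      _ ≤ _ := le_self_add
  induction a using WellFoundedLT.induction generalizing b with
  | ind a iha =>
  induction b using WellFoundedLT.induction with
  | ind b ihb =>
  intro n m x y hx hy ha hb
  refine hsum_le_of ?_ ?_
  · intro a' ha'
    obtain ⟨n', x', hx', e, h⟩ := key a' p x n hp hx (ha ▸ ha')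
    refine (iha a' ha' b n' m x' y hx' hy e hb).trans_lt ?_
    rcases h with h | ⟨rfl, h⟩
    · exact small _ _ _ _ (H _ _ hx' hy) (by omega)
    · simpa using hsum_lt_left y h
  · intro b' hb'
    obtain ⟨m', y', hy', e, h⟩ := key b' p y m hp hy (hb ▸ hb')
    refine (ihb b' hb' n m' x y' hx hy' ha e).trans_lt ?_
    rcases h with h | ⟨rfl, h⟩
    · exact small _ _ _ _ (H _ _ hx hy') (by omega)
    · simpa using hsum_lt_right x h

theorem hsum_lt_opow (c : Ordinal.{u}) :
    ∀ a b : Ordinal.{u}, a < ω ^ c → b < ω ^ c → hsum a b < ω ^ c := by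
  induction c using Ordinal.limitRecOn with
  | zero =>
    intro a b ha hb
    rw [opow_zero, Order.lt_one_iff] at *
    subst ha hb
    refine le_antisymm (hsum_le_of ?_ ?_) bot_le
    · intro a' h; exact absurd h (not_lt_bot)
    · intro a' h; exact absurd h (not_lt_bot)
  | add_one c ih =>
    intro a b ha hb
    have hp : (0 : Ordinal.{u}) < ω ^ c := opow_pos _ omega0_pos
    have dec : ∀ a : Ordinal.{u}, a < ω ^ (c + 1) →
        ∃ (n : ℕ) (x : Ordinal.{u}), x < ω ^ c ∧ a = ω ^ c * n + x := by
      intro a ha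
      have : a / ω ^ c < ω := by
        rw [← Ordinal.lt_mul_iff_div_lt hp.ne']
        simpa [opow_add] using ha
      obtain ⟨n, hn⟩ := Ordinal.lt_omega0.1 this
      exact ⟨n, a % ω ^ c, Ordinal.mod_lt _ hp.ne', by
        rw [← hn]; exact (Ordinal.div_add_mod a _).symm⟩
    obtain ⟨n, x, hx, ea⟩ := dec a ha
    obtain ⟨m, y, hy, eb⟩ := dec b hb
    refine (hsum_decomp _ hp ih a b n m x y hx hy ea eb).trans_lt ?_
    calc ω ^ c * ((n + m : ℕ) : Ordinal.{u}) + hsum x y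
        < ω ^ c * ((n + m : ℕ) : Ordinal.{u}) + ω ^ c := by simpa using ih x y hx hy
      _ = ω ^ c * ((n + m + 1 : ℕ) : Ordinal.{u}) := by
          rw [Nat.cast_add_one (n + m), mul_add, mul_one]
      _ < ω ^ c * ω := by
          rw [mul_lt_mul_iff_right₀ hp]; exact Ordinal.natCast_lt_omega0 _
      _ = _ := by rw [opow_add, opow_one]
  | limit c hc ih =>
    intro a b ha hb
    rw [Ordinal.lt_opow_of_isSuccLimit omega0_ne_zero hc] at ha hb
    obtain ⟨c1, h1, ha⟩ := ha
    obtain ⟨c2, h2, hb⟩ := hb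
    have hm : max c1 c2 < c := max_lt h1 h2
    refine (ih _ hm a b (ha.trans_le ?_) (hb.trans_le ?_)).trans_le ?_
    · exact opow_le_opow_right omega0_pos (le_max_left _ _)
    · exact opow_le_opow_right omega0_pos (le_max_right _ _)
    · exact opow_le_opow_right omega0_pos hm.le

/-! ### Oscillation derivatives -/

section osc
variable {K : Type*} [TopologicalSpace K]

theorem oscDeriv_zero (f : K → ℝ) (ε : ℝ) (H : Set K) : oscDeriv f ε H (0 : Ordinal.{u}) = H := by
  unfold oscDeriv; exact Ordinal.limitRecOn_zero ..

theorem oscDeriv_succ (f : K → ℝ) (ε : ℝ) (H : Set K) (α : Ordinal.{u}) :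
    oscDeriv f ε H (α + 1) = oscStep f ε (oscDeriv f ε H α) := by
  unfold oscDeriv; exact Ordinal.limitRecOn_add_one ..

theorem oscDeriv_limit (f : K → ℝ) (ε : ℝ) (H : Set K) (α : Ordinal.{u})
    (h : Order.IsSuccLimit α) :
    oscDeriv f ε H α = ⋂ (β : Ordinal.{u}) (_ : β < α), oscDeriv f ε H β := by
  unfold oscDeriv; rw [Ordinal.limitRecOn_limit _ _ _ _ h]

theorem oscDeriv_anti (f : K → ℝ) (ε : ℝ) (H : Set K) (α : Ordinal.{u}) :
    ∀ β ≤ α, oscDeriv f ε H α ⊆ oscDeriv f ε H β := by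
  induction α using Ordinal.limitRecOn with
  | zero => intro β hβ; rw [le_bot_iff.1 hβ]; rfl
  | add_one α ih =>
    intro β hβ
    rcases hβ.eq_or_lt with rfl | h
    · rfl
    · refine Set.Subset.trans ?_ (ih β (Order.lt_add_one_iff.1 h))
      rw [oscDeriv_succ]
      exact fun x hx => hx.1
  | limit α hα ih =>
    intro β hβ
    rcases hβ.eq_or_lt with rfl | h
    · rfl
    · rw [oscDeriv_limit _ _ _ _ hα]
      exact Set.iInter₂_subset β h

theorem oscStep_closed (f : K → ℝ) (ε : ℝ) {A : Set K} (hA : IsClosed A) :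
    IsClosed (oscStep f ε A) := by
  rw [← isOpen_compl_iff, isOpen_iff_forall_mem_open]
  intro x hx
  by_cases hxA : x ∈ A
  · have : ∃ U : Set K, IsOpen U ∧ x ∈ U ∧
        ¬ ∃ x₁ ∈ U ∩ A, ∃ x₂ ∈ U ∩ A, ε ≤ |f x₁ - f x₂| := by
      by_contra! hcon
      exact hx ⟨hxA, hcon⟩
    obtain ⟨U, hU, hxU, hn⟩ := this
    exact ⟨U, fun y hy hy' => hn (hy'.2 U hU hy), hU, hxU⟩
  · exact ⟨Aᶜ, fun y hy hy' => hy hy'.1, hA.isOpen_compl, hxA⟩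

theorem oscDeriv_closed (f : K → ℝ) (ε : ℝ) (α : Ordinal.{u}) :
    IsClosed (oscDeriv f ε Set.univ α) := by
  induction α using Ordinal.limitRecOn with
  | zero => rw [oscDeriv_zero]; exact isClosed_univ
  | add_one α ih => rw [oscDeriv_succ]; exact oscStep_closed f ε ih
  | limit α hα ih =>
    rw [oscDeriv_limit _ _ _ _ hα]
    exact isClosed_iInter fun β => isClosed_iInter fun h => ih β h

/-- The rank function of the oscillation derivation. -/
theorem exists_rank (f : K → ℝ) (ε : ℝ) (Λ : Ordinal.{u})
    (hΛ : oscDeriv f ε Set.univ Λ = ∅) :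
    ∃ r : K → Ordinal.{u}, (∀ x, r x < Λ) ∧ ∀ x, ∃ U : Set K, IsOpen U ∧ x ∈ U ∧
      (∀ z ∈ U, r z ≤ r x) ∧
      ∀ z₁ ∈ U, ∀ z₂ ∈ U, r z₁ = r x → r z₂ = r x → |f z₁ - f z₂| < ε := by
  have h1 : ∀ x, ∃ r : Ordinal.{u}, r < Λ ∧ ∀ α, x ∈ oscDeriv f ε Set.univ α ↔ α ≤ r := by
    intro x
    have hne : {α : Ordinal.{u} | x ∉ oscDeriv f ε Set.univ α}.Nonempty :=
      ⟨Λ, by simp [hΛ]⟩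
    obtain ⟨s, hs, hmin⟩ : ∃ s, x ∉ oscDeriv f ε Set.univ s ∧
        ∀ t, x ∉ oscDeriv f ε Set.univ t → s ≤ t :=
      ⟨sInf _, csInf_mem hne, fun t ht => csInf_le' ht⟩
    have hlt : ∀ t < s, x ∈ oscDeriv f ε Set.univ t := fun t ht => by
      by_contra hc; exact absurd (hmin t hc) (not_le.2 ht)
    rcases Ordinal.zero_or_succ_or_isSuccLimit s with rfl | ⟨r, rfl⟩ | hlim
    · rw [oscDeriv_zero] at hs; exact absurd (Set.mem_univ x) hs
    · have hr : r < Λ := Order.add_one_le_iff.1 (hmin Λ (by simp [hΛ]))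
      refine ⟨r, hr, fun α => ⟨fun h => ?_, fun h => hlt α (Order.lt_add_one_iff.2 h)⟩⟩
      by_contra hc
      exact hs (oscDeriv_anti f ε _ α _ (Order.add_one_le_iff.2 (not_le.1 hc)) h)
    · exfalso
      rw [oscDeriv_limit _ _ _ _ hlim] at hs
      exact hs (Set.mem_iInter₂.2 hlt)
  choose r hr hr' using h1
  refine ⟨r, hr, fun x => ?_⟩
  have hx : x ∉ oscDeriv f ε Set.univ (r x + 1) := by
    rw [hr']; simp
  have hx2 := hx
  rw [oscDeriv_succ] at hx2
  have : ∃ U : Set K, IsOpen U ∧ x ∈ U ∧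
      ¬ ∃ x₁ ∈ U ∩ oscDeriv f ε Set.univ (r x), ∃ x₂ ∈ U ∩ oscDeriv f ε Set.univ (r x),
        ε ≤ |f x₁ - f x₂| := by
    by_contra! hcon
    exact hx2 ⟨(hr' x _).2 le_rfl, hcon⟩
  obtain ⟨U, hU, hxU, hn⟩ := this
  refine ⟨U ∩ (oscDeriv f ε Set.univ (r x + 1))ᶜ,
    hU.inter (oscDeriv_closed f ε _).isOpen_compl, ⟨hxU, hx⟩, ?_, ?_⟩
  · intro z hz
    have := hz.2
    rw [Set.mem_compl_iff, hr', not_le] at this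
    exact Order.lt_add_one_iff.1 this
  · intro z₁ h₁ z₂ h₂ e₁ e₂
    by_contra hc
    exact hn ⟨z₁, ⟨h₁.1, (hr' _ _).2 e₁.ge⟩, z₂, ⟨h₂.1, (hr' _ _).2 e₂.ge⟩, not_lt.1 hc⟩

theorem oscDeriv_empty_of_beta (f : K → ℝ) (ξ : Ordinal.{u})
    (hξ : ξ < (Cardinal.aleph 1).ord) (h : beta f ≤ ω ^ ξ) (ε : ℝ) (hε : 0 < ε) :
    oscDeriv f ε Set.univ (ω ^ ξ) = ∅ := by
  have h1 : betaEpsOn f ε Set.univ ≤ ω ^ ξ :=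
    (Ordinal.le_iSup.{u, 0} (fun e : {e : ℝ // 0 < e} => betaEpsOn f e.1 Set.univ) ⟨ε, hε⟩).trans h
  unfold betaEpsOn emptyIndex at h1
  split_ifs at h1 with hex
  · have hm : oscDeriv f ε Set.univ (sInf {α | oscDeriv f ε Set.univ α = ∅}) = ∅ :=
      csInf_mem (s := {α | oscDeriv f ε Set.univ α = ∅}) hex
    exact Set.subset_empty_iff.1 (hm ▸ oscDeriv_anti f ε _ _ _ h1)
  · exfalso
    rw [Cardinal.ord_aleph] at h1 hξ
    have : ω ^ ξ < ω_ (1 : Ordinal.{u}) := by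
      refine Ordinal.isPrincipal_opow_omega 1 ?_ hξ
      exact Ordinal.omega0_lt_omega_one
    exact absurd h1 (not_le.2 this)

theorem lex_lt {p a a' s t : Ordinal.{u}} (hs : s < p) (h : a' < a) :
    p * a' + s < p * a + t :=
  calc p * a' + s < p * a' + p := by simpa using hs
    _ = p * (a' + 1) := by rw [mul_add, mul_one]
    _ ≤ p * a := by gcongr; exact Order.add_one_le_of_lt h
    _ ≤ _ := le_self_add

end osc

theorem statement19 {K : Type*} [MetricSpace K] [CompactSpace K]
    (ξ₁ ξ₂ : Ordinal) (hξ₁ : ξ₁ < (Cardinal.aleph 1).ord) (hξ₂ : ξ₂ < (Cardinal.aleph 1).ord)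
    (f g : K → ℝ) (hf1 : BaireOne f) (hg1 : BaireOne g)
    (hf : beta f ≤ Ordinal.omega0 ^ ξ₁) (hg : beta g ≤ Ordinal.omega0 ^ ξ₂) :
    beta (f * g) ≤ Ordinal.omega0 ^ (max (ξ₁ + ξ₂) (ξ₂ + ξ₁)) := by
  set p := ω ^ ξ₁ with hp
  set q := ω ^ ξ₂ with hq
  refine Ordinal.iSup_le fun ⟨ε, hε⟩ => ?_
  have rf := fun (δ : {e : ℝ // 0 < e}) =>
    exists_rank f δ.1 p (oscDeriv_empty_of_beta f ξ₁ hξ₁ hf δ.1 δ.2)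
  have rg := fun (δ : {e : ℝ // 0 < e}) =>
    exists_rank g δ.1 q (oscDeriv_empty_of_beta g ξ₂ hξ₂ hg δ.1 δ.2)
  choose rf rfl' rf' using rf
  choose rg rgl' rg' using rg
  let one : {e : ℝ // 0 < e} := ⟨1, one_pos⟩
  let d : {e : ℝ // 0 < e} → {e : ℝ // 0 < e} := fun M => ⟨ε / (2 * M.1), by
    have := M.2; positivity⟩
  have dM : ∀ M : {e : ℝ // 0 < e}, M.1 * (d M).1 = ε / 2 := fun M => by
    have := M.2
    show M.1 * (ε / (2 * M.1)) = ε / 2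
    field_simp
  -- local bounds on the levels
  let Bf : {e : ℝ // 0 < e} → K → Prop := fun M x =>
    ∃ U : Set K, IsOpen U ∧ x ∈ U ∧ ∀ z ∈ U, rf one z = rf one x → |f z| ≤ M.1
  let Bg : {e : ℝ // 0 < e} → K → Prop := fun M x =>
    ∃ U : Set K, IsOpen U ∧ x ∈ U ∧ ∀ z ∈ U, rg one z = rg one x → |g z| ≤ M.1
  have Bf_ex : ∀ x, ∃ M, Bf M x := fun x => by
    obtain ⟨U, hU, hxU, -, h⟩ := rf' one x
    refine ⟨⟨|f x| + 1, by positivity⟩, U, hU, hxU, fun z hz e => ?_⟩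
    have h1 : |f z - f x| < 1 := h z hz x hxU e rfl
    have h2 := abs_sub_abs_le_abs_sub (f z) (f x)
    show |f z| ≤ |f x| + 1
    linarith
  have Bg_ex : ∀ x, ∃ M, Bg M x := fun x => by
    obtain ⟨U, hU, hxU, -, h⟩ := rg' one x
    refine ⟨⟨|g x| + 1, by positivity⟩, U, hU, hxU, fun z hz e => ?_⟩
    have h1 : |g z - g x| < 1 := h z hz x hxU e rfl
    have h2 := abs_sub_abs_le_abs_sub (g z) (g x)
    show |g z| ≤ |g x| + 1
    linarith
  let F : {e : ℝ // 0 < e} → K → Ordinal := fun M x => q * rf one x + rg (d M) x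
  let G : {e : ℝ // 0 < e} → K → Ordinal := fun M x => p * rg one x + rf (d M) x
  have key : ∀ γ : Ordinal, ∀ x ∈ oscDeriv (f * g) ε Set.univ γ, ∀ Mf Mg, Bf Mf x → Bg Mg x →
      γ ≤ hsum (F Mf x) (G Mg x) := by
    intro γ
    induction γ using Ordinal.limitRecOn with
    | zero => intro x _ Mf Mg _ _; exact bot_le
    | limit γ hγ ih =>
      intro x hx Mf Mg h1 h2
      refine le_of_forall_lt fun γ' hγ' => ?_
      have hs := hγ.add_one_lt hγ'
      exact Order.add_one_le_iff.1
        (ih _ hs x (oscDeriv_anti _ _ _ _ _ hs.le hx) Mf Mg h1 h2)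
    | add_one γ ih =>
      intro x hx Mf Mg h1 h2
      by_contra hcon
      rw [Order.add_one_le_iff, not_lt] at hcon
      obtain ⟨U1, oU1, xU1, b1⟩ := id h1
      obtain ⟨U2, oU2, xU2, b2⟩ := id h2
      obtain ⟨V1, oV1, xV1, l1, -⟩ := rf' one x
      obtain ⟨V2, oV2, xV2, l2, -⟩ := rg' one x
      obtain ⟨W1, oW1, xW1, m1, n1⟩ := rf' (d Mg) x
      obtain ⟨W2, oW2, xW2, m2, n2⟩ := rg' (d Mf) x
      rw [oscDeriv_succ] at hx
      have T : ∀ z ∈ (U1 ∩ U2) ∩ (V1 ∩ V2) ∩ (W1 ∩ W2), z ∈ oscDeriv (f * g) ε Set.univ γ →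
          rf one z = rf one x ∧ rg one z = rg one x ∧ rf (d Mg) z = rf (d Mg) x ∧
            rg (d Mf) z = rg (d Mf) x := by
        rintro z ⟨⟨⟨u1, u2⟩, v1, v2⟩, w1, w2⟩ hz
        have A : ∃ M, Bf M z ∧ F M z ≤ F Mf x ∧ (F M z = F Mf x →
            rf one z = rf one x ∧ rg (d Mf) z = rg (d Mf) x) := by
          rcases (l1 z v1).eq_or_lt with e | h
          · refine ⟨Mf, ⟨U1, oU1, u1, fun y hy e' => b1 y hy (e'.trans e)⟩, ?_, ?_⟩
            · show q * rf one z + rg (d Mf) z ≤ q * rf one x + rg (d Mf) x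
              rw [e]; gcongr; exact m2 z w2
            · intro e'
              replace e' : q * rf one z + rg (d Mf) z = q * rf one x + rg (d Mf) x := e'
              rw [e] at e'
              exact ⟨e, by simpa using e'⟩
          · obtain ⟨M, hM⟩ := Bf_ex z
            have : F M z < F Mf x := lex_lt (rgl' _ z) h
            exact ⟨M, hM, this.le, fun e => absurd e this.ne⟩
        have B : ∃ M, Bg M z ∧ G M z ≤ G Mg x ∧ (G M z = G Mg x →
            rg one z = rg one x ∧ rf (d Mg) z = rf (d Mg) x) := by
          rcases (l2 z v2).eq_or_lt with e | h
          · refine ⟨Mg, ⟨U2, oU2, u2, fun y hy e' => b2 y hy (e'.trans e)⟩, ?_, ?_⟩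
            · show p * rg one z + rf (d Mg) z ≤ p * rg one x + rf (d Mg) x
              rw [e]; gcongr; exact m1 z w1
            · intro e'
              replace e' : p * rg one z + rf (d Mg) z = p * rg one x + rf (d Mg) x := e'
              rw [e] at e'
              exact ⟨e, by simpa using e'⟩
          · obtain ⟨M, hM⟩ := Bg_ex z
            have : G M z < G Mg x := lex_lt (rfl' _ z) h
            exact ⟨M, hM, this.le, fun e => absurd e this.ne⟩
        obtain ⟨M, hM, le1, eq1⟩ := A
        obtain ⟨N, hN, le2, eq2⟩ := B
        have hle := ih z hz M N hM hN
        have E1 : F M z = F Mf x := by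
          by_contra hne
          exact absurd (hle.trans_lt (((hsum_lt_left _ (lt_of_le_of_ne le1 hne)).trans_le
            (hsum_mono le_rfl le2)).trans_le hcon)) (lt_irrefl _)
        have E2 : G N z = G Mg x := by
          by_contra hne
          exact absurd (hle.trans_lt (((hsum_lt_right _ (lt_of_le_of_ne le2 hne)).trans_le
            (hsum_mono le1 le_rfl)).trans_le hcon)) (lt_irrefl _)
        exact ⟨(eq1 E1).1, (eq2 E2).1, (eq2 E2).2, (eq1 E1).2⟩
      obtain ⟨z, ⟨hzU, hzD⟩, y, ⟨hyU, hyD⟩, hosc⟩ := hx.2 ((U1 ∩ U2) ∩ (V1 ∩ V2) ∩ (W1 ∩ W2))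
        (((oU1.inter oU2).inter (oV1.inter oV2)).inter (oW1.inter oW2))
        ⟨⟨⟨xU1, xU2⟩, xV1, xV2⟩, xW1, xW2⟩
      obtain ⟨z1, z2, z3, z4⟩ := T z hzU hzD
      obtain ⟨y1, y2, y3, y4⟩ := T y hyU hyD
      have k1 : |f z| ≤ Mf.1 := b1 z hzU.1.1.1 z1
      have k2 : |g y| ≤ Mg.1 := b2 y hyU.1.1.2 y2
      have k3 : |f z - f y| < (d Mg).1 := n1 z hzU.2.1 y hyU.2.1 z3 y3
      have k4 : |g z - g y| < (d Mf).1 := n2 z hzU.2.2 y hyU.2.2 z4 y4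
      have e1 : (f * g) z - (f * g) y = f z * (g z - g y) + (f z - f y) * g y := by
        simp only [Pi.mul_apply]; ring
      rw [e1] at hosc
      have k5 := hosc.trans (abs_add_le _ _)
      rw [abs_mul, abs_mul] at k5
      have k6 : |f z| * |g z - g y| ≤ Mf.1 * |g z - g y| := by gcongr
      have k7 : Mf.1 * |g z - g y| < Mf.1 * (d Mf).1 := mul_lt_mul_of_pos_left k4 Mf.2
      have k8 : |f z - f y| * |g y| ≤ Mg.1 * |f z - f y| := by
        rw [mul_comm]; gcongr
      have k9 : Mg.1 * |f z - f y| < Mg.1 * (d Mg).1 := mul_lt_mul_of_pos_left k3 Mg.2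
      rw [dM] at k7 k9
      linarith
  have emp : oscDeriv (f * g) ε Set.univ (ω ^ max (ξ₁ + ξ₂) (ξ₂ + ξ₁)) = ∅ := by
    rw [Set.eq_empty_iff_forall_notMem]
    intro x hx
    obtain ⟨Mf, h1⟩ := Bf_ex x
    obtain ⟨Mg, h2⟩ := Bg_ex x
    refine absurd (key _ x hx Mf Mg h1 h2) (not_le.2 (hsum_lt_opow _ _ _ ?_ ?_))
    · refine (lex_lt (a := p) (t := 0) (rgl' _ x) (rfl' _ x)).trans_le ?_
      rw [add_zero, hp, hq, ← opow_add]
      exact opow_le_opow_right omega0_pos (le_max_right _ _)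
    · refine (lex_lt (a := q) (t := 0) (rfl' _ x) (rgl' _ x)).trans_le ?_
      rw [add_zero, hp, hq, ← opow_add]
      exact opow_le_opow_right omega0_pos (le_max_left _ _)
  show emptyIndex (oscDeriv (f * g) ε Set.univ) ≤ _
  unfold emptyIndex
  rw [dif_pos ⟨_, emp⟩]
  exact csInf_le' emp
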